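/- Suppose the length partition has constant block lengths n_i = η for all i, so n = ℓη, and let t ≤ s. Then: q^{m(s−t+1)} · #{E ∈ F_{q^m}^{s×n} : srw(E) = t and rank_{q^m}(E) ≠ t} ≤ t · #{E ∈ F_{q^m}^{s×n} : srw(E) = t}. (Equivalently, for E drawn uniformly at random among the matrices of sum-rank weight t, the probability that E does not satisfy the full-rank condition rank_{q^m}(E) = t is at most t·q^{−m(s−t+1)}.) -/

import Mathlib

open Matrix Finset

/-- Sum-rank weight of `E ∈ F_{q^m}^{s×(ℓη)}` for constant block length `η`. -/
noncomputable def srw (Fq : Type) [Field Fq] {K : Type} [Field K] [Algebra Fq K]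
    {s ℓ η : ℕ} (E : Matrix (Fin s) (Fin ℓ × Fin η) K) : ℕ :=
  ∑ i : Fin ℓ, Module.finrank Fq
    (Submodule.span Fq (Set.range fun j : Fin η => fun r : Fin s => E r (i, j)))

/-- The product form of the union bound on the number of linearly dependent families. -/
lemma mul_pow_le_add_mul_prod_sub {P Q s t : ℕ} (h : ∀ i < t, P * Q ^ i ≤ Q ^ s) :
    P * (Q ^ s) ^ t ≤ t * (Q ^ s) ^ t + P * ∏ i : Fin t, (Q ^ s - Q ^ (i : ℕ)) := by
  rw [Fin.prod_univ_eq_prod_range (fun i => Q ^ s - Q ^ i)]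
  induction t with
  | zero => simp
  | succ k ih =>
    have ih := ih fun i hi => h i (by omega)
    have hk := h k (by omega)
    rw [Finset.prod_range_succ]
    set G := ∏ i ∈ Finset.range k, (Q ^ s - Q ^ i) with hG
    have hGle : G ≤ (Q ^ s) ^ k := by
      calc G ≤ ∏ _i ∈ Finset.range k, Q ^ s :=
            Finset.prod_le_prod' fun i _ => Nat.sub_le _ _
        _ = _ := by simp
    set N := Q ^ s
    have h1 : N ≤ (N - Q ^ k) + Q ^ k := by omega
    have h2 : P * G * N ≤ P * G * (N - Q ^ k) + (P * Q ^ k) * G := by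
      calc P * G * N ≤ P * G * ((N - Q ^ k) + Q ^ k) := Nat.mul_le_mul_left _ h1
        _ = _ := by ring
    have h3 : (P * Q ^ k) * G ≤ N * N ^ k := Nat.mul_le_mul hk hGle
    have h4 := Nat.mul_le_mul_right N ih
    rw [pow_succ]
    nlinarith

/-- Conditioning on a set that contains every good element lowers the proportion of bad ones. -/
lemma mul_le_mul_of_add_eq {P t N G a g c : ℕ} (hc : a + g = c) (hG : G ≤ g) (hN : c ≤ N)
    (h : P * N ≤ t * N + P * G) : P * a ≤ t * c := by
  rcases le_total P t with hPt | hPt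
  · exact Nat.mul_le_mul hPt (by omega)
  · obtain ⟨d, rfl⟩ := Nat.exists_eq_add_of_le hPt
    have h1 : d * N ≤ (t + d) * G := by nlinarith
    have h2 : d * c ≤ d * N := Nat.mul_le_mul_left _ hN
    have h3 : (t + d) * G ≤ (t + d) * g := Nat.mul_le_mul_left _ hG
    subst hc
    nlinarith

section

variable {Fq K : Type} [Field Fq] [Field K] [Algebra Fq K] {s ℓ η : ℕ}

variable (Fq) in
/-- The `Fq`-linear map sending a coefficient vector to the combination of the columns of the
`i`-th block. -/
noncomputable def blockMap (E : Matrix (Fin s) (Fin ℓ × Fin η) K) (i : Fin ℓ) :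
    (Fin η → Fq) →ₗ[Fq] (Fin s → K) :=
  Fintype.linearCombination Fq fun j r => E r (i, j)

variable (Fq) in
/-- The `Fq`-linear map sending coefficients to the combination of all columns. -/
noncomputable def columnMap (E : Matrix (Fin s) (Fin ℓ × Fin η) K) :
    (Fin ℓ → Fin η → Fq) →ₗ[Fq] (Fin s → K) :=
  LinearMap.lsum Fq (fun _ => Fin η → Fq) Fq (blockMap Fq E)

lemma blockMap_single (E : Matrix (Fin s) (Fin ℓ × Fin η) K) (i : Fin ℓ) (j : Fin η) :
    blockMap Fq E i (Pi.single j 1) = fun r => E r (i, j) := by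
  simp [blockMap]

lemma columnMap_single (E : Matrix (Fin s) (Fin ℓ × Fin η) K) (i : Fin ℓ) (v : Fin η → Fq) :
    columnMap Fq E (Pi.single i v) = blockMap Fq E i v := by
  simp only [columnMap, LinearMap.lsum_apply, LinearMap.sum_apply, LinearMap.comp_apply,
    LinearMap.proj_apply]
  rw [Finset.sum_eq_single i] <;> simp +contextual

lemma columnMap_injective :
    Function.Injective (columnMap Fq : Matrix (Fin s) (Fin ℓ × Fin η) K → _) := by
  intro E E' h
  ext r ⟨i, j⟩
  have := congrFun (LinearMap.congr_fun h (Pi.single i (Pi.single j 1))) r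
  simpa [columnMap_single, blockMap_single] using this

lemma exists_columnMap_eq (L : (Fin ℓ → Fin η → Fq) →ₗ[Fq] (Fin s → K)) :
    ∃ E : Matrix (Fin s) (Fin ℓ × Fin η) K, columnMap Fq E = L := by
  refine ⟨Matrix.of fun r p => L (Pi.single p.1 (Pi.single p.2 1)) r, ?_⟩
  refine LinearMap.pi_ext' fun i => LinearMap.pi_ext' fun j => LinearMap.ext_ring ?_
  simp only [LinearMap.comp_apply, LinearMap.single_apply]
  rw [columnMap_single, blockMap_single]
  rfl

lemma srw_eq_sum_finrank_quotient (E : Matrix (Fin s) (Fin ℓ × Fin η) K) :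
    srw Fq E = ∑ i, Module.finrank Fq ((Fin η → Fq) ⧸ LinearMap.ker (blockMap Fq E i)) := by
  refine Finset.sum_congr rfl fun i _ => ?_
  rw [(blockMap Fq E i).quotKerEquivRange.finrank_eq, blockMap, Fintype.range_linearCombination]

lemma rank_eq_finrank_span_columnMap (E : Matrix (Fin s) (Fin ℓ × Fin η) K) :
    E.rank = Module.finrank K
      (Submodule.span K (LinearMap.range (columnMap Fq E) : Set (Fin s → K))) := by
  rw [Matrix.rank_eq_finrank_span_cols]
  suffices h : Submodule.span K (Set.range E.col) =
      Submodule.span K (LinearMap.range (columnMap Fq E) : Set (Fin s → K)) by rw [h]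
  apply le_antisymm
  · refine Submodule.span_mono ?_
    rintro _ ⟨⟨i, j⟩, rfl⟩
    exact ⟨Pi.single i (Pi.single j 1), by rw [columnMap_single, blockMap_single]; rfl⟩
  · rw [Submodule.span_le]
    rintro _ ⟨x, rfl⟩
    simp only [columnMap, LinearMap.lsum_apply, LinearMap.sum_apply, LinearMap.comp_apply,
      LinearMap.proj_apply, blockMap, Fintype.linearCombination_apply]
    refine Submodule.sum_mem _ fun i _ => Submodule.sum_mem _ fun j _ => ?_
    rw [← algebraMap_smul K]
    exact Submodule.smul_mem _ _ (Submodule.subset_span ⟨(i, j), rfl⟩)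

lemma finrank_quotient_pi (V : Fin ℓ → Submodule Fq (Fin η → Fq)) :
    Module.finrank Fq ((Fin ℓ → Fin η → Fq) ⧸ Submodule.pi Set.univ V) =
      ∑ i, Module.finrank Fq ((Fin η → Fq) ⧸ V i) := by
  rw [(Submodule.quotientPi V).finrank_eq, Module.finrank_pi_fintype]

lemma pi_ker_blockMap_le (E : Matrix (Fin s) (Fin ℓ × Fin η) K) :
    Submodule.pi Set.univ (fun i => LinearMap.ker (blockMap Fq E i)) ≤
      LinearMap.ker (columnMap Fq E) := by
  intro x hx
  simp only [Submodule.mem_pi, Set.mem_univ, true_imp_iff, LinearMap.mem_ker] at hx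
  simp [columnMap, LinearMap.lsum_apply, LinearMap.sum_apply, hx]

lemma card_ker_blockMap_eq_le [Fintype Fq] [Fintype K] {t : ℕ}
    (V : Fin ℓ → Submodule Fq (Fin η → Fq))
    (hV : ∑ i, Module.finrank Fq ((Fin η → Fq) ⧸ V i) = t) :
    Nat.card {E : Matrix (Fin s) (Fin ℓ × Fin η) K //
      (fun i => LinearMap.ker (blockMap Fq E i)) = V} ≤ (Fintype.card K ^ s) ^ t := by
  let b := Module.finBasisOfFinrankEq Fq _ ((finrank_quotient_pi V).trans hV)
  have hcard : Nat.card (Fin t → Fin s → K) = (Fintype.card K ^ s) ^ t := by simp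
  rw [← hcard]
  refine Nat.card_le_card_of_injective
    (fun E => (b.constr Fq).symm ((Submodule.pi Set.univ V).liftQ (columnMap Fq E.1)
      (by have := pi_ker_blockMap_le (Fq := Fq) E.1; rwa [E.2] at this))) ?_
  intro E E' h
  have h := (b.constr Fq).symm.injective h
  apply Subtype.ext
  apply columnMap_injective (Fq := Fq)
  have := congrArg (fun L => L ∘ₗ (Submodule.pi Set.univ V).mkQ) h
  simpa only [Submodule.liftQ_mkQ] using this

lemma exists_of_linearIndependent {t : ℕ} (V : Fin ℓ → Submodule Fq (Fin η → Fq))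
    (b : Module.Basis (Fin t) Fq ((Fin ℓ → Fin η → Fq) ⧸ Submodule.pi Set.univ V))
    {f : Fin t → Fin s → K} (hf : LinearIndependent K f) :
    ∃ E : Matrix (Fin s) (Fin ℓ × Fin η) K,
      columnMap Fq E = b.constr Fq f ∘ₗ (Submodule.pi Set.univ V).mkQ ∧
      (fun i => LinearMap.ker (blockMap Fq E i)) = V ∧ E.rank = t := by
  obtain ⟨E, hE⟩ := exists_columnMap_eq (b.constr Fq f ∘ₗ (Submodule.pi Set.univ V).mkQ)
  refine ⟨E, hE, ?_, ?_⟩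
  · have hfq : LinearIndependent Fq f := LinearIndependent.restrict_scalars' Fq hf
    have hinj : LinearMap.ker (b.constr Fq f) = ⊥ := by
      refine LinearMap.ker_eq_bot'.2 fun x hx => ?_
      rw [b.constr_apply_fintype Fq] at hx
      have := Fintype.linearIndependent_iff.1 hfq _ hx
      exact b.equivFun.map_eq_zero_iff.1 (funext this)
    funext i
    ext v
    rw [LinearMap.mem_ker, ← columnMap_single, hE, LinearMap.comp_apply, ← LinearMap.mem_ker,
      hinj, Submodule.mem_bot, Submodule.mkQ_apply, Submodule.Quotient.mk_eq_zero]
    simp only [Submodule.mem_pi, Set.mem_univ, true_imp_iff]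
    constructor
    · intro h
      simpa using h i
    · intro h j
      rcases eq_or_ne j i with rfl | hji
      · simpa using h
      · simp [hji]
  · rw [rank_eq_finrank_span_columnMap (Fq := Fq), hE,
      LinearMap.range_comp_of_range_eq_top _ (Submodule.range_mkQ _), Module.Basis.constr_range,
      Submodule.span_span_of_tower, finrank_span_eq_card hf, Fintype.card_fin]

lemma prod_le_card_ker_blockMap_eq [Fintype Fq] [Fintype K] {t : ℕ} (hts : t ≤ s)
    (V : Fin ℓ → Submodule Fq (Fin η → Fq))
    (hV : ∑ i, Module.finrank Fq ((Fin η → Fq) ⧸ V i) = t) :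
    ∏ i : Fin t, (Fintype.card K ^ s - Fintype.card K ^ (i : ℕ)) ≤
      Nat.card {E : Matrix (Fin s) (Fin ℓ × Fin η) K //
        (fun i => LinearMap.ker (blockMap Fq E i)) = V ∧ E.rank = t} := by
  let b := Module.finBasisOfFinrankEq Fq _ ((finrank_quotient_pi V).trans hV)
  have hcard := card_linearIndependent (K := K) (V := Fin s → K) (k := t) (by simpa using hts)
  rw [Module.finrank_fin_fun] at hcard
  rw [← hcard]
  choose F hF hF' using fun f : {f : Fin t → Fin s → K // LinearIndependent K f} =>
    exists_of_linearIndependent V b f.2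
  refine Nat.card_le_card_of_injective (fun f => ⟨F f, hF' f⟩) ?_
  intro f f' h
  have h : F f = F f' := congrArg Subtype.val h
  have h2 := (hF f).symm.trans ((congrArg (columnMap Fq) h).trans (hF f'))
  rw [LinearMap.cancel_right (Submodule.mkQ_surjective _)] at h2
  exact Subtype.ext ((b.constr Fq).injective h2)

end

/-- Theorem 4 of the paper. For constant block lengths `η` and
`t ≤ s`, for `E` uniform among matrices of sum-rank weight `t`, the probability that `E`
violates the full-rank condition is at most `t·q^{−m(s−t+1)}`; as a counting statement:
`q^{m(s−t+1)} · #{E : srw(E) = t, rank_{q^m}(E) ≠ t} ≤ t · #{E : srw(E) = t}`. -/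
theorem stmt12 (q m s ℓ η t : ℕ) (Fq K : Type) [Field Fq] [Fintype Fq] [Field K] [Fintype K]
    [Algebra Fq K]
    (hq : Fintype.card Fq = q) (hK : Fintype.card K = q ^ m)
    (hm : 1 ≤ m) (hs : 1 ≤ s) (hl : 1 ≤ ℓ) (hη : 1 ≤ η) (hts : t ≤ s) :
    q ^ (m * (s - t + 1)) *
        Nat.card {E : Matrix (Fin s) (Fin ℓ × Fin η) K // srw Fq E = t ∧ E.rank ≠ t}
    ≤ t * Nat.card {E : Matrix (Fin s) (Fin ℓ × Fin η) K // srw Fq E = t} := by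
  classical
  subst hq
  set P := Fintype.card Fq ^ (m * (s - t + 1)) with hP
  have hP' : P = Fintype.card K ^ (s - t + 1) := by rw [hP, hK, pow_mul]
  let κ : Matrix (Fin s) (Fin ℓ × Fin η) K → Fin ℓ → Submodule Fq (Fin η → Fq) :=
    fun E i => LinearMap.ker (blockMap Fq E i)
  let σ : (Fin ℓ → Submodule Fq (Fin η → Fq)) → ℕ :=
    fun V => ∑ i, Module.finrank Fq ((Fin η → Fq) ⧸ V i)
  have hsrw : ∀ E : Matrix (Fin s) (Fin ℓ × Fin η) K, srw Fq E = σ (κ E) :=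
    srw_eq_sum_finrank_quotient
  have : Fintype (Submodule Fq (Fin η → Fq)) := Fintype.ofFinite _
  have key : ∀ V, σ V = t →
      P * #{E : Matrix (Fin s) (Fin ℓ × Fin η) K | κ E = V ∧ E.rank ≠ t} ≤
        t * #{E : Matrix (Fin s) (Fin ℓ × Fin η) K | κ E = V} := by
    intro V hV
    have hN := card_ker_blockMap_eq_le (s := s) (K := K) V hV
    have hG := prod_le_card_ker_blockMap_eq (K := K) hts V hV
    rw [Nat.card_eq_fintype_card, Fintype.card_subtype] at hN hG
    refine mul_le_mul_of_add_eq ?_ hG hN (mul_pow_le_add_mul_prod_sub fun i hi => ?_)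
    · rw [add_comm, ← Finset.filter_filter, ← Finset.filter_filter]
      exact Finset.card_filter_add_card_filter_not _
    · rw [hP', ← pow_add]
      exact Nat.pow_le_pow_right Fintype.card_pos (by omega)
  rw [Nat.card_eq_fintype_card, Fintype.card_subtype, Nat.card_eq_fintype_card,
    Fintype.card_subtype,
    Finset.card_eq_sum_card_fiberwise (f := κ) (t := {V | σ V = t})
      (fun E hE => by simpa [← hsrw] using (Finset.mem_filter.1 hE).2.1),
    Finset.card_eq_sum_card_fiberwise (f := κ) (t := {V | σ V = t})
      (fun E hE => by simpa [← hsrw] using (Finset.mem_filter.1 hE).2),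
    Finset.mul_sum, Finset.mul_sum]
  refine Finset.sum_le_sum fun V hV => ?_
  have hV : σ V = t := by simpa using hV
  have hbad : ({E | srw Fq E = t ∧ E.rank ≠ t} : Finset (Matrix (Fin s) (Fin ℓ × Fin η) K)).filter
      (κ · = V) = ({E | κ E = V ∧ E.rank ≠ t} : Finset _) := by
    ext E
    simp only [Finset.mem_filter, Finset.mem_univ, true_and, hsrw]
    constructor
    · rintro ⟨⟨-, h⟩, h'⟩
      exact ⟨h', h⟩
    · rintro ⟨h', h⟩
      exact ⟨⟨h' ▸ hV, h⟩, h'⟩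
  have hall : ({E | srw Fq E = t} : Finset (Matrix (Fin s) (Fin ℓ × Fin η) K)).filter
      (κ · = V) = ({E | κ E = V} : Finset _) := by
    ext E
    simp only [Finset.mem_filter, Finset.mem_univ, true_and, hsrw]
    exact ⟨fun h => h.2, fun h => ⟨h ▸ hV, h⟩⟩
  rw [hbad, hall]
  exact key V hV
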